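/- arXiv:1207.5168 — 2 statements merged into one kernel-verified Lean document; each statement's English description precedes it below -/
import Mathlib

section
/- Let A be an alphabet with 1 ∈ A and δ_A > 1/2, and write A_max = max A. Let M be a real number with M ≥ 2⁹·A_max³·(log M)³, and let p ≥ 1 be an integer such that the continuant c_p of the sequence of p ones satisfies √(log M) ≤ c_p ≤ 2·√(log M). Let S₂ be the set of finite sequences D = (d₁,…,d_k) of even length k ≥ 2p with all entries in A such that d₁ = … = d_p = 1, d_{k−p+1} = … = d_k = 1, and M/(64·A_max²) ≤ ⟨D⟩ ≤ M. Then #S₂ ≥ M^{2δ_A}/(2¹³·A_max⁴·(log M)²). -/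
/-- Continuant `⟨d₁,…,d_k⟩`. -/
def cont : List ℕ → ℕ
  | [] => 1
  | [d] => d
  | d :: e :: D => d * cont (e :: D) + cont D

/-- The Gauss map `y ↦ {1/y}`. -/
noncomputable def gaussMap (y : ℝ) : ℝ := Int.fract (1 / y)

/-- The set `E_A`. -/
def cfSet (A : Finset ℕ) : Set ℝ :=
  {x | x ∈ Set.Ioo (0:ℝ) 1 ∧ Irrational x ∧
    ∀ n : ℕ, ∃ a ∈ A, (a : ℤ) = ⌊1 / (gaussMap^[n] x)⌋}

/-- `δ_A`, the Hausdorff dimension of `E_A`. -/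
noncomputable def cfDim (A : Finset ℕ) : ℝ := (dimH (cfSet A)).toReal

/-- The set `S₂`: sequences over `A` of even length `k ≥ 2p` whose first `p` and last `p`
entries equal `1`, with continuant in `[M/(64 A_max²), M]`. -/
def S2set (A : Finset ℕ) (Am M : ℝ) (p : ℕ) : Set (List ℕ) :=
  {L | Even L.length ∧ 2 * p ≤ L.length ∧ (∀ d ∈ L, d ∈ A) ∧
    L.take p = List.replicate p 1 ∧ L.drop (L.length - p) = List.replicate p 1 ∧
    M / (64 * Am ^ 2) ≤ (cont L : ℝ) ∧ (cont L : ℝ) ≤ M}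

section Continuant

theorem one_le_cont : ∀ {L : List ℕ}, (∀ d ∈ L, 0 < d) → 1 ≤ cont L
  | [], _ => le_rfl
  | [d], h => h d (by simp)
  | d :: e :: D, h => by
    have := one_le_cont (L := D) fun x hx => h x (by simp [hx])
    simp only [cont]
    omega

theorem cont_le_cont_cons {d : ℕ} (hd : 0 < d) (L : List ℕ) : cont L ≤ cont (d :: L) := by
  cases L with
  | nil => simpa [cont, Nat.one_le_iff_ne_zero, Nat.pos_iff_ne_zero] using hd
  | cons e D =>
    simp only [cont]
    nlinarith

theorem length_le_cont : ∀ {L : List ℕ}, (∀ d ∈ L, 0 < d) → L.length ≤ cont L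
  | [], _ => Nat.zero_le _
  | [d], h => h d (by simp)
  | d :: e :: D, h => by
    have h₁ := length_le_cont (L := e :: D) fun x hx => h x (List.mem_cons_of_mem _ hx)
    have h₂ := one_le_cont (L := D) fun x hx => h x (by simp [hx])
    have h₃ : 0 < d := h d (by simp)
    simp only [cont, List.length_cons] at *
    nlinarith

theorem cont_mul_le_cont_append : ∀ u v : List ℕ, cont u * cont v ≤ cont (u ++ v)
  | [], v => by simp [cont]
  | [d], [] => by simp [cont]
  | [d], e :: v => by simp [cont]
  | d :: e :: u, v => by
    have h₁ := cont_mul_le_cont_append (e :: u) v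
    have h₂ := cont_mul_le_cont_append u v
    simp only [cont, List.cons_append] at *
    nlinarith [Nat.mul_le_mul_left d h₁]

theorem cont_append_le : ∀ {u v : List ℕ}, (∀ d ∈ u, 0 < d) → (∀ d ∈ v, 0 < d) →
    cont (u ++ v) ≤ 2 * (cont u * cont v)
  | [], v, _, _ => by simp [cont]; omega
  | [d], [], _, _ => by simp [cont]; omega
  | [d], e :: v, hu, hv => by
    have h₁ := cont_le_cont_cons (hv e (by simp)) v
    have h₂ : 0 < d := hu d (by simp)
    simp only [cont, List.cons_append, List.nil_append]
    nlinarith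
  | d :: e :: u, v, hu, hv => by
    have h₁ := cont_append_le (u := e :: u) (fun x hx => hu x (List.mem_cons_of_mem _ hx)) hv
    have h₂ := cont_append_le (u := u) (fun x hx => hu x (by simp [hx])) hv
    simp only [cont, List.cons_append] at *
    nlinarith [Nat.mul_le_mul_left d h₁]

theorem finite_setOf_cont_le {A : Finset ℕ} (hpos : ∀ a ∈ A, 0 < a) (N : ℝ) :
    {L : List ℕ | (∀ d ∈ L, d ∈ A) ∧ (cont L : ℝ) ≤ N}.Finite := by
  have hfin := (List.finite_length_le A ⌊N⌋₊).image (List.map Subtype.val)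
  refine hfin.subset fun L ⟨hL, hN⟩ => ?_
  lift L to List A using hL
  refine ⟨L, ?_, rfl⟩
  have h := length_le_cont (L := L.map Subtype.val) (by simpa using fun a ha _ => hpos a ha)
  rw [List.length_map] at h
  exact h.trans (Nat.le_floor hN)

end Continuant

section Branch

/-- The inverse branch `x ↦ 1 / (d₁ + 1 / (d₂ + ⋯ + 1 / (d_k + x)))` of the Gauss map. -/
noncomputable def cfBranch : List ℕ → ℝ → ℝ
  | [], x => x
  | d :: D, x => 1 / (d + cfBranch D x)

/-- The denominator `⟨d₁,…,d_k⟩ + x ⟨d₁,…,d_{k-1}⟩` of `cfBranch`. -/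
noncomputable def cfDenom : List ℕ → ℝ → ℝ
  | [], _ => 1
  | d :: D, x => (d + cfBranch D x) * cfDenom D x

theorem cfBranch_append (u v : List ℕ) (x : ℝ) :
    cfBranch (u ++ v) x = cfBranch u (cfBranch v x) := by
  induction u with
  | nil => rfl
  | cons d u ih => simp [cfBranch, ih]

theorem cfBranch_nonneg (L : List ℕ) {x : ℝ} (hx : 0 ≤ x) : 0 ≤ cfBranch L x := by
  induction L with
  | nil => exact hx
  | cons d L ih => simp only [cfBranch]; positivity

theorem cont_le_cfDenom : ∀ {L : List ℕ}, (∀ d ∈ L, 0 < d) → ∀ {x : ℝ}, 0 ≤ x →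
    (cont L : ℝ) ≤ cfDenom L x
  | [], _, x, _ => by simp [cont, cfDenom]
  | [d], _, x, hx => by simp [cont, cfDenom, cfBranch, hx]
  | d :: e :: D, h, x, hx => by
    have h₁ := cont_le_cfDenom (L := e :: D) (fun y hy => h y (List.mem_cons_of_mem _ hy)) hx
    have h₂ := cont_le_cfDenom (L := D) (fun y hy => h y (by simp [hy])) hx
    have he : (0 : ℝ) < e := by exact_mod_cast h e (by simp)
    have hpos : 0 < e + cfBranch D x := add_pos_of_pos_of_nonneg he (cfBranch_nonneg D hx)
    have key : cfDenom (d :: e :: D) x = d * cfDenom (e :: D) x + cfDenom D x := by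
      simp only [cfDenom, cfBranch]
      field_simp
    rw [key]
    simp only [cont]
    push_cast
    gcongr

theorem abs_cfBranch_sub_mul {L : List ℕ} (hL : ∀ d ∈ L, 0 < d) {x y : ℝ} (hx : 0 ≤ x)
    (hy : 0 ≤ y) :
    |cfBranch L x - cfBranch L y| * (cfDenom L x * cfDenom L y) = |x - y| := by
  induction L with
  | nil => simp [cfBranch, cfDenom]
  | cons d L ih =>
    have hd : (0 : ℝ) < d := by exact_mod_cast hL d (by simp)
    have hx' : 0 < d + cfBranch L x := add_pos_of_pos_of_nonneg hd (cfBranch_nonneg L hx)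
    have hy' : 0 < d + cfBranch L y := add_pos_of_pos_of_nonneg hd (cfBranch_nonneg L hy)
    have key : cfBranch (d :: L) x - cfBranch (d :: L) y =
        -(cfBranch L x - cfBranch L y) / ((d + cfBranch L x) * (d + cfBranch L y)) := by
      simp only [cfBranch]
      field_simp
      ring
    rw [← ih fun a ha => hL a (List.mem_cons_of_mem _ ha), key, abs_div, abs_neg,
      abs_of_pos (mul_pos hx' hy')]
    simp only [cfDenom]
    field_simp

theorem lipschitzOnWith_cfBranch {L : List ℕ} (hL : ∀ d ∈ L, 0 < d) {T : NNReal} (hT : 0 < T)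
    (hTL : (T : ℝ) ≤ cont L) {E : Set ℝ} (hE : ∀ x ∈ E, 0 ≤ x) :
    LipschitzOnWith (T ^ 2)⁻¹ (cfBranch L) E := by
  refine LipschitzOnWith.of_dist_le_mul fun x hx y hy => ?_
  have hT' : (0 : ℝ) < T := hT
  have hQ : (T : ℝ) ^ 2 ≤ cfDenom L x * cfDenom L y := by
    rw [sq]
    exact mul_le_mul (hTL.trans (cont_le_cfDenom hL (hE x hx)))
      (hTL.trans (cont_le_cfDenom hL (hE y hy))) hT'.le
      (hT'.le.trans (hTL.trans (cont_le_cfDenom hL (hE x hx))))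
  rw [Real.dist_eq, Real.dist_eq, ← abs_cfBranch_sub_mul hL (hE x hx) (hE y hy)]
  push_cast
  rw [inv_mul_eq_div, le_div_iff₀ (by positivity)]
  gcongr

end Branch

section CfSet

theorem exists_eq_cfBranch_singleton {A : Finset ℕ} {x : ℝ} (hx : x ∈ cfSet A) :
    ∃ a ∈ A, ∃ y ∈ cfSet A, x = cfBranch [a] y := by
  obtain ⟨⟨hx0, hx1⟩, hirr, hdig⟩ := hx
  obtain ⟨a, haA, ha⟩ := hdig 0
  have hirr' : Irrational (gaussMap x) := by
    have h : Irrational (1 / x) := by simpa using hirr.inv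
    exact h.sub_intCast _
  refine ⟨a, haA, gaussMap x, ⟨⟨?_, Int.fract_lt_one _⟩, hirr', fun n => ?_⟩, ?_⟩
  · exact lt_of_le_of_ne (Int.fract_nonneg _) hirr'.ne_zero.symm
  · simpa using hdig (n + 1)
  · have h : (a : ℝ) + gaussMap x = 1 / x := by
      rw [← Int.floor_add_fract (1 / x), gaussMap]
      congr 1
      exact_mod_cast ha
    simp [cfBranch, h]

/-- Words of even length over `A` whose continuant lies in `(T, K T]`. -/
def evenWords (A : Finset ℕ) (T K : ℝ) : Set (List ℕ) :=
  {L | Even L.length ∧ (∀ d ∈ L, d ∈ A) ∧ T < cont L ∧ (cont L : ℝ) ≤ K * T}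

theorem exists_evenWords_cfBranch {A : Finset ℕ} (hpos : ∀ a ∈ A, 0 < a) {m : ℕ}
    (hm : ∀ a ∈ A, a ≤ m) (hm1 : 1 ≤ m) {T : ℝ} (hT : 1 ≤ T) {x : ℝ} (hx : x ∈ cfSet A) :
    ∃ L ∈ evenWords A T (4 * m ^ 2), ∃ y ∈ cfSet A, x = cfBranch L y := by
  by_contra! hcon
  have key : ∀ n : ℕ, ∃ L : List ℕ, L.length = 2 * n ∧ (∀ d ∈ L, d ∈ A) ∧ (cont L : ℝ) ≤ T ∧
      ∃ y ∈ cfSet A, x = cfBranch L y := by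
    intro n
    induction n with
    | zero => exact ⟨[], rfl, by simp, by simpa [cont] using hT, x, hx, rfl⟩
    | succ n ih =>
      obtain ⟨L, hlen, hLA, hLT, y, hy, hxy⟩ := ih
      obtain ⟨a, ha, z, hz, hyz⟩ := exists_eq_cfBranch_singleton hy
      obtain ⟨b, hb, w, hw, hzw⟩ := exists_eq_cfBranch_singleton hz
      have hA' : ∀ d ∈ L ++ [a, b], d ∈ A := by
        intro d hd
        simp only [List.mem_append, List.mem_cons, List.not_mem_nil, or_false] at hd
        rcases hd with hd | rfl | rfl
        exacts [hLA d hd, ha, hb]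
      have hxw : x = cfBranch (L ++ [a, b]) w := by
        rw [cfBranch_append, hxy, hyz, hzw]
        rfl
      refine ⟨L ++ [a, b], by simp [hlen]; ring, hA', ?_, w, hw, hxw⟩
      by_contra! hlt
      refine hcon _ ⟨⟨n + 1, by simp [hlen]; ring⟩, hA', hlt, ?_⟩ w hw hxw
      have h₁ : cont (L ++ [a, b]) ≤ 2 * (cont L * cont [a, b]) :=
        cont_append_le (fun d hd => hpos d (hLA d hd)) (by simpa using ⟨hpos a ha, hpos b hb⟩)
      have h₂ : cont [a, b] ≤ 2 * m ^ 2 := by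
        simp only [cont]
        nlinarith [Nat.mul_le_mul (hm a ha) (hm b hb), Nat.mul_le_mul hm1 hm1]
      calc (cont (L ++ [a, b]) : ℝ) ≤ 2 * (cont L * cont [a, b]) := by exact_mod_cast h₁
        _ ≤ 2 * (T * (2 * m ^ 2)) := by
          gcongr
          exact_mod_cast h₂
        _ = 4 * m ^ 2 * T := by ring
  obtain ⟨L, hlen, hLA, hLT, -⟩ := key (⌊T⌋₊ + 1)
  have h₁ := length_le_cont fun d hd => hpos d (hLA d hd)
  have h₂ : cont L ≤ ⌊T⌋₊ := Nat.le_floor hLT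
  omega

end CfSet

section Dimension

open MeasureTheory Filter Topology
open scoped ENNReal NNReal

/-- The pieces of level `n` of a set `E` under an iterated function system `f`. -/
def ifsPiece {ι X : Type*} (f : ι → X → X) (E : Set X) : (n : ℕ) → (Fin n → ι) → Set X
  | 0, _ => E
  | n + 1, w => f (w 0) '' ifsPiece f E n (Fin.tail w) ∩ E

theorem ifsPiece_subset {ι X : Type*} (f : ι → X → X) (E : Set X) (n : ℕ) (w : Fin n → ι) :
    ifsPiece f E n w ⊆ E := by
  cases n with
  | zero => exact subset_rfl
  | succ n => exact Set.inter_subset_right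

theorem subset_iUnion_ifsPiece {ι X : Type*} {f : ι → X → X} {E : Set X}
    (h : E ⊆ ⋃ i, f i '' E) (n : ℕ) : E ⊆ ⋃ w, ifsPiece f E n w := by
  induction n with
  | zero => exact fun x hx => Set.mem_iUnion.2 ⟨Fin.elim0, hx⟩
  | succ n ih =>
    intro x hx
    obtain ⟨i, y, hy, rfl⟩ := Set.mem_iUnion.1 (h hx)
    obtain ⟨w, hw⟩ := Set.mem_iUnion.1 (ih hy)
    exact Set.mem_iUnion.2 ⟨Fin.cons i w, ⟨y, by simpa using hw, by simp⟩, hx⟩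

theorem ediam_ifsPiece_le {ι X : Type*} [PseudoEMetricSpace X] {f : ι → X → X} {E : Set X}
    {r : ℝ≥0} (hf : ∀ i, LipschitzOnWith r (f i) E) (n : ℕ) (w : Fin n → ι) :
    Metric.ediam (ifsPiece f E n w) ≤ (r : ℝ≥0∞) ^ n * Metric.ediam E := by
  induction n with
  | zero => simp [ifsPiece]
  | succ n ih =>
    calc Metric.ediam (ifsPiece f E (n + 1) w)
        ≤ Metric.ediam (f (w 0) '' ifsPiece f E n (Fin.tail w)) :=
          Metric.ediam_mono Set.inter_subset_left
      _ ≤ r * Metric.ediam (ifsPiece f E n (Fin.tail w)) :=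
          Metric.ediam_image_le_iff.2 fun x hx y hy =>
            (hf (w 0) (ifsPiece_subset f E n _ hx) (ifsPiece_subset f E n _ hy)).trans
              (by gcongr; exact Metric.edist_le_ediam_of_mem hx hy)
      _ ≤ r * ((r : ℝ≥0∞) ^ n * Metric.ediam E) := by gcongr; exact ih _
      _ = (r : ℝ≥0∞) ^ (n + 1) * Metric.ediam E := by ring

/-- A bounded set covered by its images under `k` contractions of ratio `r` has dimension at
most `s` as soon as `k r ^ s ≤ 1`. -/
theorem dimH_le_of_subset_iUnion_image {ι X : Type*} [Fintype ι] [EMetricSpace X]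
    {f : ι → X → X} {E : Set X} (hE : Metric.ediam E ≠ ∞) {r : ℝ≥0} (hr : r < 1)
    (hf : ∀ i, LipschitzOnWith r (f i) E) (hcov : E ⊆ ⋃ i, f i '' E) {s : ℝ≥0}
    (hs : (Fintype.card ι : ℝ≥0∞) * (r : ℝ≥0∞) ^ (s : ℝ) ≤ 1) : dimH E ≤ s := by
  borelize X
  refine dimH_le_of_hausdorffMeasure_ne_top (ne_top_of_le_ne_top
    (ENNReal.rpow_ne_top_of_nonneg s.coe_nonneg hE) ?_)
  have hlim : Tendsto (fun n : ℕ => (r : ℝ≥0∞) ^ n * Metric.ediam E) atTop (𝓝 0) := by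
    simpa using ENNReal.Tendsto.mul_const
      (ENNReal.tendsto_pow_atTop_nhds_zero_of_lt_one (by exact_mod_cast hr)) (Or.inr hE)
  refine (Measure.hausdorffMeasure_le_liminf_sum (s : ℝ) E _ hlim (fun n w => ifsPiece f E n w)
    (Eventually.of_forall fun n => ediam_ifsPiece_le hf n)
    (Eventually.of_forall fun n => subset_iUnion_ifsPiece hcov n)).trans ?_
  refine (liminf_le_liminf (Eventually.of_forall fun n => ?_)).trans
    (liminf_const (f := (atTop : Filter ℕ)) (Metric.ediam E ^ (s : ℝ))).le
  calc ∑ w, Metric.ediam (ifsPiece f E n w) ^ (s : ℝ)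
      ≤ ∑ _w : Fin n → ι, ((r : ℝ≥0∞) ^ n * Metric.ediam E) ^ (s : ℝ) := by
        gcongr with w
        exact ediam_ifsPiece_le hf n w
    _ = ((Fintype.card ι : ℝ≥0∞) * (r : ℝ≥0∞) ^ (s : ℝ)) ^ n * Metric.ediam E ^ (s : ℝ) := by
        rw [Finset.sum_const, Finset.card_univ, Fintype.card_fun, Fintype.card_fin, nsmul_eq_mul,
          ENNReal.mul_rpow_of_nonneg _ _ s.coe_nonneg, mul_pow, ← ENNReal.rpow_natCast (r : ℝ≥0∞),
          ← ENNReal.rpow_mul, mul_comm (n : ℝ), ENNReal.rpow_mul, ENNReal.rpow_natCast]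
        push_cast
        ring
    _ ≤ 1 ^ n * Metric.ediam E ^ (s : ℝ) := by gcongr
    _ = Metric.ediam E ^ (s : ℝ) := by simp

theorem dimH_cfSet_le_one (A : Finset ℕ) : dimH (cfSet A) ≤ 1 :=
  (dimH_mono (Set.subset_univ _)).trans Real.dimH_univ.le

theorem evenWords_finite {A : Finset ℕ} (hpos : ∀ a ∈ A, 0 < a) (T K : ℝ) :
    (evenWords A T K).Finite :=
  (finite_setOf_cont_le hpos (K * T)).subset fun _ hL => ⟨hL.2.1, hL.2.2.2⟩

theorem dimH_cfSet_le {A : Finset ℕ} (hpos : ∀ a ∈ A, 0 < a) {m : ℕ}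
    (hm : ∀ a ∈ A, a ≤ m) (hm1 : 1 ≤ m) {T : ℝ} (hT : 1 < T) {s : ℝ≥0}
    (hs : ((evenWords A T (4 * m ^ 2)).ncard : ℝ) ≤ T ^ (2 * (s : ℝ))) :
    dimH (cfSet A) ≤ s := by
  lift T to ℝ≥0 using by linarith
  have hT0 : 0 < T := by exact_mod_cast one_pos.trans hT
  have := (evenWords_finite hpos (T : ℝ) (4 * m ^ 2)).fintype
  refine dimH_le_of_subset_iUnion_image
    (f := fun L : evenWords A (T : ℝ) (4 * m ^ 2) => cfBranch L) (r := (T ^ 2)⁻¹)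
    ?_ ?_ (fun L => ?_) (fun x hx => ?_) ?_
  · have h : cfSet A ⊆ Set.Icc 0 1 := fun x hx => ⟨hx.1.1.le, hx.1.2.le⟩
    exact (Metric.isBounded_Icc (0 : ℝ) 1 |>.subset h).ediam_ne_top
  · exact inv_lt_one_of_one_lt₀ (one_lt_pow₀ (by exact_mod_cast hT) two_ne_zero)
  · exact lipschitzOnWith_cfBranch (fun d hd => hpos d (L.2.2.1 d hd)) hT0 L.2.2.2.1.le
      fun x hx => hx.1.1.le
  · obtain ⟨L, hL, y, hy, rfl⟩ := exists_evenWords_cfBranch hpos hm hm1 hT.le hx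
    exact Set.mem_iUnion.2 ⟨⟨L, hL⟩, y, hy, rfl⟩
  · rw [← Nat.card_eq_fintype_card, Nat.card_coe_set_eq, ← ENNReal.coe_natCast,
      ← ENNReal.coe_rpow_of_nonneg _ s.coe_nonneg, ← ENNReal.coe_mul]
    have h : ((evenWords A (T : ℝ) (4 * m ^ 2)).ncard : ℝ≥0) ≤ T ^ (2 * (s : ℝ)) := by
      exact_mod_cast hs
    rw [NNReal.inv_rpow, ← NNReal.rpow_natCast, ← NNReal.rpow_mul]
    norm_cast
    refine mul_inv_le_one_of_le₀ ?_ zero_le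
    exact_mod_cast h

theorem rpow_cfDim_le_ncard_evenWords {A : Finset ℕ} (hpos : ∀ a ∈ A, 0 < a) {m : ℕ}
    (hm : ∀ a ∈ A, a ≤ m) (hm1 : 1 ≤ m) {T : ℝ} (hT : 1 < T) (hδ : 0 < cfDim A) :
    T ^ (2 * cfDim A) ≤ ((evenWords A T (4 * m ^ 2)).ncard : ℝ) := by
  by_contra! hlt
  have hcont : ContinuousAt (fun s : ℝ => T ^ (2 * s)) (cfDim A) := by
    have : T ≠ 0 := by positivity
    fun_prop (disch := assumption)
  obtain ⟨s, ⟨hs, hs0⟩, hsδ⟩ := (((hcont.eventually_const_lt hlt).and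
    (lt_mem_nhds hδ)).filter_mono nhdsWithin_le_nhds |>.and
    (self_mem_nhdsWithin (a := cfDim A) (s := Set.Iio (cfDim A)))).exists
  lift s to ℝ≥0 using hs0.le
  have h := ENNReal.toReal_mono ENNReal.coe_ne_top (dimH_cfSet_le hpos hm hm1 hT hs.le)
  exact absurd h (not_le.2 hsδ)

end Dimension

theorem append_mem_S2set {A : Finset ℕ} (hpos : ∀ a ∈ A, 0 < a) (h1 : 1 ∈ A) {m M : ℝ}
    (hm : 0 < m) (hM : 0 ≤ M) (p : ℕ) {L : List ℕ}
    (hL : L ∈ evenWords A (M / (16 * m ^ 2 * (cont (List.replicate p 1) : ℝ) ^ 2))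
      (4 * m ^ 2)) :
    List.replicate p 1 ++ L ++ List.replicate p 1 ∈ S2set A m M p := by
  obtain ⟨heven, hLA, hlt, hle⟩ := hL
  have hLpos : ∀ d ∈ L, 0 < d := fun d hd => hpos d (hLA d hd)
  have hone : ∀ d ∈ List.replicate p 1, d = 1 := fun d hd => List.eq_of_mem_replicate hd
  have hu : ∀ d ∈ List.replicate p 1, 0 < d := fun d hd => by simp [hone d hd]
  have huL : ∀ d ∈ List.replicate p 1 ++ L, 0 < d := fun d hd =>
    (List.mem_append.1 hd).elim (hu d) (hLpos d)
  have hc : 0 < (cont (List.replicate p 1) : ℝ) := by exact_mod_cast one_le_cont hu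
  have hlow : cont (List.replicate p 1) * cont L * cont (List.replicate p 1) ≤
      cont (List.replicate p 1 ++ L ++ List.replicate p 1) :=
    (Nat.mul_le_mul_right _ (cont_mul_le_cont_append _ _)).trans (cont_mul_le_cont_append _ _)
  have hupp : cont (List.replicate p 1 ++ L ++ List.replicate p 1) ≤
      2 * (2 * (cont (List.replicate p 1) * cont L) * cont (List.replicate p 1)) :=
    (cont_append_le huL hu).trans
      (Nat.mul_le_mul_left _ (Nat.mul_le_mul_right _ (cont_append_le hu hLpos)))
  set c := cont (List.replicate p 1)
  refine ⟨?_, ?_, ?_, ?_, ?_, ?_, ?_⟩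
  · obtain ⟨k, hk⟩ := heven
    exact ⟨p + k, by simp [hk]; ring⟩
  · simp; omega
  · intro d hd
    simp only [List.mem_append] at hd
    rcases hd with (hd | hd) | hd
    exacts [hone d hd ▸ h1, hLA d hd, hone d hd ▸ h1]
  · simp [List.append_assoc]
  · have : (List.replicate p 1 ++ L ++ List.replicate p 1).length - p =
        (List.replicate p 1 ++ L).length := by simp [add_comm]
    rw [this, List.drop_left]
  · calc M / (64 * m ^ 2) ≤ M / (16 * m ^ 2) := by gcongr; norm_num
      _ = c * (M / (16 * m ^ 2 * (c : ℝ) ^ 2)) * c := by field_simp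
      _ ≤ c * cont L * c := by gcongr
      _ ≤ _ := by exact_mod_cast hlow
  · calc (_ : ℝ) ≤ 2 * (2 * (c * cont L) * c) := by exact_mod_cast hupp
      _ ≤ 2 * (2 * (c * (4 * m ^ 2 * (M / (16 * m ^ 2 * (c : ℝ) ^ 2)))) * c) := by gcongr
      _ = M := by field_simp; ring

theorem ncard_evenWords_le_ncard_S2set {A : Finset ℕ} (hpos : ∀ a ∈ A, 0 < a) (h1 : 1 ∈ A)
    {m M : ℝ} (hm : 0 < m) (hM : 0 ≤ M) (p : ℕ) :
    (evenWords A (M / (16 * m ^ 2 * (cont (List.replicate p 1) : ℝ) ^ 2)) (4 * m ^ 2)).ncard ≤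
      (S2set A m M p).ncard := by
  refine Set.ncard_le_ncard_of_injOn (fun L => List.replicate p 1 ++ L ++ List.replicate p 1)
    (fun L hL => append_mem_S2set hpos h1 hm hM p hL) (fun L _ L' _ h => ?_)
    ((finite_setOf_cont_le hpos M).subset fun L hL => ⟨hL.2.2.1, hL.2.2.2.2.2.2⟩)
  simpa using h


/-- `#S₂ ≥ M^{2δ_A}/(2¹³ A_max⁴ (log M)²)`. -/
theorem S2_lower_bound (A : Finset ℕ) (hcard : 2 ≤ A.card) (hpos : ∀ a ∈ A, 0 < a)
    (hA : A.Nonempty) (h1 : 1 ∈ A) (hδ : 1 / 2 < cfDim A)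
    (M : ℝ) (hM : 2 ^ 9 * (A.max' hA : ℝ) ^ 3 * (Real.log M) ^ 3 ≤ M)
    (p : ℕ) (hp : 1 ≤ p)
    (hcp1 : Real.sqrt (Real.log M) ≤ (cont (List.replicate p 1) : ℝ))
    (hcp2 : (cont (List.replicate p 1) : ℝ) ≤ 2 * Real.sqrt (Real.log M)) :
    M ^ (2 * cfDim A) / (2 ^ 13 * (A.max' hA : ℝ) ^ 4 * (Real.log M) ^ 2) ≤
      ((S2set A (A.max' hA : ℝ) M p).ncard : ℝ) := by
  have hm2 : 2 ≤ A.max' hA := by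
    obtain ⟨a, ha, ha1⟩ := Finset.exists_mem_ne hcard 1
    have := A.le_max' a ha
    have := hpos a ha
    omega
  have hmax : ∀ a ∈ A, a ≤ A.max' hA := fun a ha => A.le_max' a ha
  generalize A.max' hA = m at *
  have hm2' : (2 : ℝ) ≤ m := by exact_mod_cast hm2
  have hc1 : (1 : ℝ) ≤ cont (List.replicate p 1) := by
    exact_mod_cast one_le_cont fun d hd => by simp [List.eq_of_mem_replicate hd]
  set c : ℝ := (cont (List.replicate p 1) : ℝ)
  set l := Real.log M
  have hl0 : 0 < l := Real.sqrt_pos.1 (by linarith)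
  have hcl : c ^ 2 ≤ 4 * l := by
    calc c ^ 2 ≤ (2 * √l) ^ 2 := by gcongr
      _ = 4 * l := by rw [mul_pow, Real.sq_sqrt hl0.le]; norm_num
  have hl4 : 1 / 4 ≤ l := by nlinarith
  have hM64 : 64 ≤ M := by
    calc (64 : ℝ) = 2 ^ 9 * 2 ^ 3 * (1 / 4) ^ 3 := by norm_num
      _ ≤ 2 ^ 9 * (m : ℝ) ^ 3 * l ^ 3 := by gcongr
      _ ≤ M := hM
  have hM0 : 0 < M := by linarith
  have hl1 : 1 ≤ l := by
    rw [Real.le_log_iff_exp_le hM0]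
    linarith [Real.exp_one_lt_d9]
  have hMl : 64 * (m : ℝ) ^ 2 * l < M := by
    calc 64 * (m : ℝ) ^ 2 * l < 2 ^ 9 * (m : ℝ) ^ 2 * l := by gcongr; norm_num
      _ ≤ 2 ^ 9 * (m : ℝ) ^ 3 * l ^ 3 := by
        gcongr
        · linarith
        · norm_num
        · exact le_self_pow₀ hl1 (by norm_num)
      _ ≤ M := hM
  have hT : M / (64 * (m : ℝ) ^ 2 * l) ≤ M / (16 * (m : ℝ) ^ 2 * c ^ 2) := by
    refine div_le_div_of_nonneg_left hM0.le (by positivity) ?_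
    nlinarith [mul_le_mul_of_nonneg_left hcl (sq_nonneg (m : ℝ))]
  have hT1 : 1 < M / (16 * (m : ℝ) ^ 2 * c ^ 2) :=
    lt_of_lt_of_le ((one_lt_div (by positivity)).2 hMl) hT
  have hδ1 : cfDim A ≤ 1 := by
    simpa [cfDim] using ENNReal.toReal_mono ENNReal.one_ne_top (dimH_cfSet_le_one A)
  have hδ0 : 0 < cfDim A := by linarith
  have hbase : 1 ≤ 64 * (m : ℝ) ^ 2 * l := by nlinarith
  have hcount := rpow_cfDim_le_ncard_evenWords hpos hmax (by omega) hT1 hδ0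
  have hle := ncard_evenWords_le_ncard_S2set hpos h1 (m := m) (by linarith) hM0.le p
  calc M ^ (2 * cfDim A) / (2 ^ 13 * (m : ℝ) ^ 4 * l ^ 2)
      ≤ M ^ (2 * cfDim A) / (64 * (m : ℝ) ^ 2 * l) ^ (2 : ℝ) := by
        rw [Real.rpow_two]
        gcongr
        have : 0 ≤ (m : ℝ) ^ 4 * l ^ 2 := by positivity
        nlinarith
    _ ≤ M ^ (2 * cfDim A) / (64 * (m : ℝ) ^ 2 * l) ^ (2 * cfDim A) := by
        gcongr
        linarith
    _ = (M / (64 * (m : ℝ) ^ 2 * l)) ^ (2 * cfDim A) :=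
        (Real.div_rpow hM0.le (by positivity) _).symm
    _ ≤ (M / (16 * (m : ℝ) ^ 2 * c ^ 2)) ^ (2 * cfDim A) := by gcongr
    _ ≤ ((S2set A m M p).ncard : ℝ) := hcount.trans (Nat.cast_le.2 hle)
end

section
/- Let A be an alphabet with 1 ∈ A and δ_A > 1/2, write A_max = max A, let M be a real number with M ≥ 2⁹·A_max³·(log M)³, let p ≥ 1 be an integer such that the continuant c_p of the sequence of p ones satisfies √(log M) ≤ c_p ≤ 2·√(log M), and let S₂ be the set of finite sequences D of even length k ≥ 2p over A whose first p and last p entries equal 1 and with M/(64·A_max²) ≤ ⟨D⟩ ≤ M. Suppose L is a real number with M/(64·A_max²) ≤ L ≤ M such that the set S₃(L) = {D ∈ S₂ : max(M/(64·A_max²), L·(1 − 1/log L)) ≤ ⟨D⟩ ≤ L} satisfies #S₃(L) ≥ L^{2δ_A}/(2¹⁶·A_max⁵·(log L)³). Then there exists an integer k such that the set of sequences in S₃(L) of length exactly k has cardinality at least L^{2δ_A}/(2¹⁸·A_max⁵·(log L)⁴). -/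
/-- The set `S₃(L)`. -/
def S3set (A : Finset ℕ) (Am M : ℝ) (p : ℕ) (L : ℝ) : Set (List ℕ) :=
  {D ∈ S2set A Am M p |
    max (M / (64 * Am ^ 2)) (L * (1 - 1 / Real.log L)) ≤ (cont D : ℝ) ∧ (cont D : ℝ) ≤ L}

/-- Continuants of positive entries are positive. -/
theorem cont_pos (D : List ℕ) (hD : ∀ d ∈ D, 0 < d) : 0 < cont D := by
  fun_induction cont D with
  | case1 => exact one_pos
  | case2 d => exact hD d (by simp)
  | case3 d e D _ ih => exact Nat.add_pos_right _ (ih fun x hx => hD x (by simp [hx]))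

/-- Prepending two positive entries at least doubles the continuant, so a list of length `2 * j`
has continuant at least `2 ^ j`. -/
theorem two_pow_le_cont (j : ℕ) (D : List ℕ) (hlen : D.length = 2 * j) (hD : ∀ d ∈ D, 0 < d) :
    2 ^ j ≤ cont D := by
  induction j generalizing D with
  | zero =>
    have hnil : D = [] := List.length_eq_zero_iff.mp (by simpa using hlen)
    simp [hnil, cont]
  | succ j ih =>
    match D, hlen, hD with
    | a :: b :: E, hlen, hD =>
      have hE : 2 ^ j ≤ cont E :=
        ih E (by simp only [List.length_cons] at hlen; omega) fun d hd => hD d (by simp [hd])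
      have ha : 1 ≤ a := hD a (by simp)
      have hb : 1 ≤ b := hD b (by simp)
      have hbE : cont E ≤ cont (b :: E) := by
        cases E with
        | nil => simpa [cont] using hb
        | cons c E =>
          simp only [cont]
          exact le_add_right (Nat.le_mul_of_pos_left _ hb)
      have hmul : cont (b :: E) ≤ a * cont (b :: E) := Nat.le_mul_of_pos_left _ ha
      simp only [cont, pow_succ]
      omega

/-- A list of even length with positive entries and continuant at most `L` has length at most
`4 * log L`. -/
theorem half_length_le_two_mul_log {L : ℝ} {D : List ℕ} (hD : ∀ d ∈ D, 0 < d)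
    (heven : Even D.length) (hL : (cont D : ℝ) ≤ L) :
    ((D.length / 2 : ℕ) : ℝ) ≤ 2 * Real.log L := by
  have hpow : (2 : ℝ) ^ (D.length / 2) ≤ L :=
    le_trans (mod_cast two_pow_le_cont _ D (Nat.two_mul_div_two_of_even heven).symm hD) hL
  have hlog := Real.log_le_log (by positivity) hpow
  rw [Real.log_pow] at hlog
  have hnonneg : (0 : ℝ) ≤ (D.length / 2 : ℕ) := Nat.cast_nonneg _
  nlinarith [Real.log_two_gt_d9]

/-- Pigeonhole over the possible lengths of a set of lists of even positive length. -/
theorem exists_length_fiber {S : Set (List ℕ)} {T R : ℝ} (hT : 0 < T) (hR : 0 < R)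
    (hcard : T ≤ S.ncard) (heven : ∀ D ∈ S, Even D.length) (hne : ∀ D ∈ S, 0 < D.length)
    (hlen : ∀ D ∈ S, ((D.length / 2 : ℕ) : ℝ) ≤ R) :
    ∃ k : ℕ, T / R ≤ ({D ∈ S | D.length = k}.ncard : ℝ) := by
  have hncard : 0 < S.ncard := by exact_mod_cast hT.trans_le hcard
  have hfin : S.Finite := Set.finite_of_ncard_pos hncard
  have hmaps : ∀ D ∈ hfin.toFinset, D.length / 2 ∈ Finset.Icc 1 ⌊R⌋₊ := by
    intro D hD
    rw [Set.Finite.mem_toFinset] at hD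
    obtain ⟨m, hm⟩ := heven D hD
    have hpos := hne D hD
    exact Finset.mem_Icc.mpr ⟨by omega, Nat.le_floor (hlen D hD)⟩
  obtain ⟨D, hD⟩ := Set.nonempty_of_ncard_ne_zero hncard.ne'
  obtain ⟨j, -, hj⟩ := Finset.exists_le_card_fiber_of_nsmul_le_card_of_maps_to
    (b := T / R) hmaps ⟨_, hmaps D (hfin.mem_toFinset.mpr hD)⟩ (by
      rw [← Set.ncard_eq_toFinset_card S hfin, nsmul_eq_mul, Nat.card_Icc, Nat.add_sub_cancel]
      calc (⌊R⌋₊ : ℝ) * (T / R) ≤ R * (T / R) := by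
            gcongr
            exact Nat.floor_le hR.le
        _ = T := mul_div_cancel₀ T hR.ne'
        _ ≤ S.ncard := hcard)
  refine ⟨2 * j, hj.trans_eq ?_⟩
  rw [← Set.ncard_coe_finset]
  congr 2
  ext D
  simp only [Finset.coe_filter, Set.Finite.mem_toFinset, Set.mem_ofPred_eq]
  refine and_congr_right fun hD => ?_
  obtain ⟨m, hm⟩ := heven D hD
  omega

/-- The size condition on `M` forces the lower end `M / (64 * a ^ 2)` above `1`. -/
theorem one_lt_div_of_log_cube_le {M a : ℝ} (ha : 1 ≤ a) (hlog : 1 / 4 ≤ Real.log M)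
    (hM : 2 ^ 9 * a ^ 3 * Real.log M ^ 3 ≤ M) : 1 < M / (64 * a ^ 2) := by
  have hcube : (1 : ℝ) ≤ a ^ 3 := one_le_pow₀ ha
  have hM8 : (8 : ℝ) ≤ M := by
    calc (8 : ℝ) = 2 ^ 9 * 1 * (1 / 4) ^ 3 := by norm_num
      _ ≤ 2 ^ 9 * a ^ 3 * Real.log M ^ 3 := by gcongr
      _ ≤ M := hM
  have hlog1 : 1 ≤ Real.log M := by
    rw [Real.le_log_iff_exp_le (by linarith)]
    linarith [Real.exp_one_lt_d9]
  rw [one_lt_div (by positivity)]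
  calc 64 * a ^ 2 < 2 ^ 9 * a ^ 2 * 1 ^ 3 := by nlinarith
    _ ≤ 2 ^ 9 * a ^ 3 * Real.log M ^ 3 := by
      gcongr
      norm_num
    _ ≤ M := hM

/-- if `L ∈ [M/(64 A_max²), M]` satisfies
`#S₃(L) ≥ L^{2δ_A}/(2¹⁶ A_max⁵ (log L)³)`, then there is a length `k` with
`#{D ∈ S₃(L) : |D| = k} ≥ L^{2δ_A}/(2¹⁸ A_max⁵ (log L)⁴)`. -/
theorem S4_lower_bound (A : Finset ℕ) (hcard : 2 ≤ A.card) (hpos : ∀ a ∈ A, 0 < a)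
    (hA : A.Nonempty) (h1 : 1 ∈ A) (hδ : 1 / 2 < cfDim A)
    (M : ℝ) (hM : 2 ^ 9 * (A.max' hA : ℝ) ^ 3 * (Real.log M) ^ 3 ≤ M)
    (p : ℕ) (hp : 1 ≤ p)
    (hcp1 : Real.sqrt (Real.log M) ≤ (cont (List.replicate p 1) : ℝ))
    (hcp2 : (cont (List.replicate p 1) : ℝ) ≤ 2 * Real.sqrt (Real.log M))
    (L : ℝ) (hL1 : M / (64 * (A.max' hA : ℝ) ^ 2) ≤ L) (hL2 : L ≤ M)
    (hS3 : L ^ (2 * cfDim A) / (2 ^ 16 * (A.max' hA : ℝ) ^ 5 * (Real.log L) ^ 3) ≤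
      ((S3set A (A.max' hA : ℝ) M p L).ncard : ℝ)) :
    ∃ k : ℕ,
      L ^ (2 * cfDim A) / (2 ^ 18 * (A.max' hA : ℝ) ^ 5 * (Real.log L) ^ 4) ≤
        (({D ∈ S3set A (A.max' hA : ℝ) M p L | D.length = k}).ncard : ℝ) := by
  have ha : (1 : ℝ) ≤ (A.max' hA : ℝ) := by exact_mod_cast A.le_max' 1 h1
  have hlogM : 1 / 4 ≤ Real.log M := by
    have hc := cont_pos (List.replicate p 1) fun d hd => by simp [List.eq_of_mem_replicate hd]
    have hc1 : (1 : ℝ) ≤ (cont (List.replicate p 1) : ℝ) := by exact_mod_cast hc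
    have hsqrt : 1 / 2 ≤ Real.sqrt (Real.log M) := by linarith
    rw [Real.le_sqrt' (by norm_num)] at hsqrt
    linarith
  have hL : 1 < L := (one_lt_div_of_log_cube_le ha hlogM hM).trans_le hL1
  have hlogL : 0 < Real.log L := Real.log_pos hL
  obtain ⟨k, hk⟩ := exists_length_fiber (R := 4 * Real.log L) (by positivity) (by positivity) hS3
    (fun D hD => hD.1.1) (fun D hD => by have := hD.1.2.1; omega)
    (fun D hD => (half_length_le_two_mul_log (fun d hd => hpos d (hD.1.2.2.1 d hd))
      hD.1.1 hD.2.2).trans (by linarith))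
  refine ⟨k, le_of_eq_of_le ?_ hk⟩
  field_simp
  norm_num
end
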